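/- Let (J₁, ·, α₁, ω₁) and (J₂, ·, α₂, ω₂) be cosymplectic Jacobi–Jordan algebras of dimension 2n+1 with Reeb vectors ξ₁, ξ₂, and let (h_i, ω_{h_i}, D_i) for i = 1, 2 be the associated symplectic JJ-algebras h_i = ker(α_i) with ω_{h_i} = ω_i|_{h_i×h_i} and anti-derivations D_i(x) = ξ_i·x. Then (J₁, α₁, ω₁) and (J₂, α₂, ω₂) are isomorphic as cosymplectic JJ-algebras if and only if there exists an isomorphism of symplectic JJ-algebras φ : h₁ → h₂ with φ ∘ D₁ = D₂ ∘ φ. -/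

import Mathlib

/-- Evaluation of the wedge product `α ∧ ωⁿ` of a 1-form `α` and a 2-form `ω` on a tuple of
`2n+1` vectors, via the normalized (characteristic-free, "shuffle/matching") formula:
the sum ranges over canonical representatives of the decompositions of `{0,…,2n}` into a
singleton (fed to `α`) and `n` ordered pairs (fed to `ω`).  `α ∧ ωⁿ ≠ 0` is rendered as
`∃ v, wedgeEval K n α ω v ≠ 0`. -/
def wedgeEval (K : Type*) [Field K] {V : Type*} (n : ℕ)
    (α : V → K) (ω : V → V → K) (v : Fin (2*n+1) → V) : K :=
  ∑ σ ∈ Finset.filter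
      (fun σ : Equiv.Perm (Fin (2*n+1)) =>
        (∀ i : Fin n, σ ⟨2*(i:ℕ)+1, by have := i.2; omega⟩ < σ ⟨2*(i:ℕ)+2, by have := i.2; omega⟩) ∧
        (∀ i j : Fin n, i < j →
          σ ⟨2*(i:ℕ)+1, by have := i.2; omega⟩ < σ ⟨2*(j:ℕ)+1, by have := j.2; omega⟩))
      Finset.univ,
    (Equiv.Perm.sign σ : ℤ) •
      (α (v (σ ⟨0, by omega⟩)) *
        ∏ i : Fin n,
          ω (v (σ ⟨2*(i:ℕ)+1, by have := i.2; omega⟩)) (v (σ ⟨2*(i:ℕ)+2, by have := i.2; omega⟩)))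

/-- The positions `0, …, 2n` as one singleton and `n` ordered pairs `(2i+1, 2i+2)`. -/
noncomputable def pairIndex (n : ℕ) : Option (Fin n × Bool) ≃ Fin (2*n+1) :=
  Equiv.ofBijective
    (fun k => match k with
      | none => ⟨0, by omega⟩
      | some (i, false) => ⟨2*(i:ℕ)+1, by have := i.2; omega⟩
      | some (i, true) => ⟨2*(i:ℕ)+2, by have := i.2; omega⟩)
    (by
      rw [Fintype.bijective_iff_injective_and_card]
      refine ⟨?_, by simp [mul_comm]⟩
      rintro (_ | ⟨i, _ | _⟩) (_ | ⟨j, _ | _⟩) h <;> simp [Fin.ext_iff] at h ⊢ <;> omega)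

/-- The permutations over which `wedgeEval` sums. -/
def IsNormalMatching {n : ℕ} (σ : Equiv.Perm (Fin (2*n+1))) : Prop :=
  (∀ i : Fin n, σ (pairIndex n (some (i, false))) < σ (pairIndex n (some (i, true)))) ∧
    StrictMono fun i : Fin n => σ (pairIndex n (some (i, false)))

/-- The involution exchanging the two members of each pair. -/
noncomputable def pairSwap (n : ℕ) : Equiv.Perm (Fin (2*n+1)) :=
  (pairIndex n).permCongr (Equiv.optionCongr ((Equiv.refl (Fin n)).prodCongr Equiv.boolNot))

/-- The permutation of the positions that acts on the pairs by `π` and exchanges the members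
of the pairs selected by `ε`. -/
noncomputable def pairPerm {n : ℕ} (π : Equiv.Perm (Fin n)) (ε : Fin n → Bool) :
    Equiv.Perm (Fin (2*n+1)) :=
  (pairIndex n).permCongr
    (Equiv.optionCongr
      (Equiv.prodCongrRight (fun i => if ε i then Equiv.boolNot else 1) *
        Equiv.prodCongrLeft (fun _ : Bool => π)))

@[simp] lemma pairSwap_none (n : ℕ) :
    pairSwap n (pairIndex n none) = pairIndex n none := by
  simp [pairSwap]

@[simp] lemma pairSwap_some {n : ℕ} (i : Fin n) (b : Bool) :
    pairSwap n (pairIndex n (some (i, b))) = pairIndex n (some (i, !b)) := by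
  simp [pairSwap]

@[simp] lemma pairPerm_none {n : ℕ} (π : Equiv.Perm (Fin n)) (ε : Fin n → Bool) :
    pairPerm π ε (pairIndex n none) = pairIndex n none := by
  simp [pairPerm]

@[simp] lemma pairPerm_some {n : ℕ} (π : Equiv.Perm (Fin n)) (ε : Fin n → Bool)
    (i : Fin n) (b : Bool) :
    pairPerm π ε (pairIndex n (some (i, b))) =
      pairIndex n (some (π i, xor (ε (π i)) b)) := by
  cases h : ε (π i) <;> simp [pairPerm, h]

lemma commute_pairPerm_pairSwap {n : ℕ} (π : Equiv.Perm (Fin n)) (ε : Fin n → Bool) :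
    Commute (pairPerm π ε) (pairSwap n) := by
  ext x
  obtain ⟨k, rfl⟩ := (pairIndex n).surjective x
  rcases k with _ | ⟨i, b⟩ <;> simp

lemma sign_pairPerm {n : ℕ} (π : Equiv.Perm (Fin n)) (ε : Fin n → Bool) :
    Equiv.Perm.sign (pairPerm π ε) = ∏ i, if ε i then -1 else 1 := by
  have hnot : Equiv.Perm.sign Equiv.boolNot = -1 := by decide
  rw [pairPerm, Equiv.Perm.sign_permCongr, Equiv.optionCongr_sign, map_mul,
    Equiv.Perm.sign_prodCongrRight, Equiv.Perm.sign_prodCongrLeft]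
  simp only [Finset.prod_const, Finset.card_univ, Fintype.card_bool, Int.units_sq, mul_one,
    apply_ite Equiv.Perm.sign, hnot, map_one]

lemma pairSwap_eq_self_iff {n : ℕ} (x : Fin (2*n+1)) :
    pairSwap n x = x ↔ x = pairIndex n none := by
  obtain ⟨k, rfl⟩ := (pairIndex n).surjective x
  rcases k with _ | ⟨i, b⟩ <;> simp

lemma IsNormalMatching.range_eq {n : ℕ} {σ : Equiv.Perm (Fin (2*n+1))}
    (hσ : IsNormalMatching σ) :
    Set.range (fun i : Fin n => σ (pairIndex n (some (i, false)))) =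
      {x | x < σ (pairSwap n (σ⁻¹ x))} := by
  ext x
  obtain ⟨y, rfl⟩ := σ.surjective x
  obtain ⟨k, rfl⟩ := (pairIndex n).surjective y
  rcases k with _ | ⟨i, _ | _⟩
  · simp
  · simpa using hσ.1 i
  · simp [(hσ.1 i).le]

/-- A normal matching is determined by the matching it induces. -/
lemma IsNormalMatching.eq_of_commute {n : ℕ} {σ h : Equiv.Perm (Fin (2*n+1))}
    (hσ : IsNormalMatching σ) (hσh : IsNormalMatching (σ * h))
    (hh : Commute h (pairSwap n)) : σ * h = σ := by
  have hsw (x) : h (pairSwap n x) = pairSwap n (h x) := by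
    simpa using congrArg (fun g : Equiv.Perm _ => g x) hh.eq
  have hconj (x) : (σ * h) (pairSwap n ((σ * h)⁻¹ x)) = σ (pairSwap n (σ⁻¹ x)) := by
    simp [mul_inv_rev, hsw]
  have hfirst : (fun i : Fin n => (σ * h) (pairIndex n (some (i, false)))) =
      fun i : Fin n => σ (pairIndex n (some (i, false))) := by
    refine (hσh.2.range_inj hσ.2).1 ?_
    rw [hσh.range_eq, hσ.range_eq]
    simp only [hconj]
  have hfst (i : Fin n) : h (pairIndex n (some (i, false))) = pairIndex n (some (i, false)) :=
    σ.injective (congrFun hfirst i)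
  suffices h = 1 by simp [this]
  ext x
  obtain ⟨k, rfl⟩ := (pairIndex n).surjective x
  rcases k with _ | ⟨i, _ | _⟩
  · have : h (pairIndex n none) = pairIndex n none :=
      (pairSwap_eq_self_iff _).1 (by rw [← hsw, pairSwap_none])
    rw [this]
    rfl
  · rw [hfst]
    rfl
  · have := hsw (pairIndex n (some (i, false)))
    rw [hfst] at this
    simpa using congrArg Fin.val this

lemma exists_isNormalMatching_mul_pairPerm {n : ℕ} (σ : Equiv.Perm (Fin (2*n+1))) :
    ∃ π ε, IsNormalMatching (σ * pairPerm π ε) := by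
  set ε : Fin n → Bool := fun i =>
    decide (σ (pairIndex n (some (i, true))) < σ (pairIndex n (some (i, false)))) with hε
  have hlt (i : Fin n) : σ (pairIndex n (some (i, ε i))) < σ (pairIndex n (some (i, !ε i))) := by
    by_cases h : σ (pairIndex n (some (i, true))) < σ (pairIndex n (some (i, false)))
    · simp [hε, h]
    · have hne : σ (pairIndex n (some (i, true))) ≠ σ (pairIndex n (some (i, false))) := by simp
      simpa [hε, h] using lt_of_le_of_ne (not_lt.1 h) hne.symm
  have hinj : Function.Injective fun i : Fin n => σ (pairIndex n (some (i, ε i))) := by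
    intro i j hij
    have := (pairIndex n).injective (σ.injective hij)
    simp only [Option.some.injEq, Prod.mk.injEq] at this
    exact this.1
  refine ⟨Tuple.sort fun i : Fin n => σ (pairIndex n (some (i, ε i))), ε, ?_, ?_⟩
  · intro i
    simp [hlt]
  · simpa [Function.comp_def] using
      (Tuple.monotone_sort fun i : Fin n => σ (pairIndex n (some (i, ε i)))).strictMono_of_injective
        (hinj.comp (Equiv.injective _))

section Wedge

variable {K V : Type*} [Field K] [AddCommGroup V] [Module K V] {n : ℕ}
  (α : V →ₗ[K] K) (ω : V →ₗ[K] V →ₗ[K] K)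

/-- The product `α(w₀) ∏ᵢ ω(wᵢ, wᵢ')`. -/
def matchingProd (w : Option (Fin n × Bool) → V) : K :=
  α (w none) * ∏ i, ω (w (some (i, false))) (w (some (i, true)))

lemma exists_linearMap_matchingProd_update [DecidableEq (Option (Fin n × Bool))]
    (w : Option (Fin n × Bool) → V) (k : Option (Fin n × Bool)) :
    ∃ L : V →ₗ[K] K, ∀ x, matchingProd α ω (Function.update w k x) = L x := by
  classical
  rcases k with _ | ⟨i, b⟩
  · refine ⟨(∏ i, ω (w (some (i, false))) (w (some (i, true)))) • α, fun x => ?_⟩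
    simp [matchingProd, mul_comm]
  · have hrest (x : V) : ∏ j ∈ Finset.univ.erase i,
        ω (Function.update w (some (i, b)) x (some (j, false)))
          (Function.update w (some (i, b)) x (some (j, true))) =
        ∏ j ∈ Finset.univ.erase i, ω (w (some (j, false))) (w (some (j, true))) :=
      Finset.prod_congr rfl fun j hj => by simp [Finset.ne_of_mem_erase hj]
    let c := α (w none) * ∏ j ∈ Finset.univ.erase i, ω (w (some (j, false))) (w (some (j, true)))
    cases b
    · refine ⟨c • ω.flip (w (some (i, true))), fun x => ?_⟩
      rw [matchingProd, ← Finset.mul_prod_erase _ _ (Finset.mem_univ i), hrest]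
      simp [c]
      ring
    · refine ⟨c • ω (w (some (i, false))), fun x => ?_⟩
      rw [matchingProd, ← Finset.mul_prod_erase _ _ (Finset.mem_univ i), hrest]
      simp [c]
      ring

/-- `matchingProd` as a multilinear map. -/
def matchingProdMultilinear : MultilinearMap K (fun _ : Option (Fin n × Bool) => V) K where
  toFun := matchingProd α ω
  map_update_add' w k x y := by
    obtain ⟨L, hL⟩ := exists_linearMap_matchingProd_update α ω w k
    simp only [hL, map_add]
  map_update_smul' w k c x := by
    obtain ⟨L, hL⟩ := exists_linearMap_matchingProd_update α ω w k
    simp only [hL, map_smul]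

/-- The signed term of `wedgeEval` attached to a permutation. -/
noncomputable def wedgeTerm (v : Fin (2*n+1) → V) (σ : Equiv.Perm (Fin (2*n+1))) : K :=
  (Equiv.Perm.sign σ : ℤ) • matchingProd α ω (v ∘ σ ∘ pairIndex n)

open Classical in
lemma wedgeEval_eq_sum_wedgeTerm (v : Fin (2*n+1) → V) :
    wedgeEval K n (fun x => α x) (fun x y => ω x y) v =
      ∑ σ with IsNormalMatching σ, wedgeTerm α ω v σ := by
  unfold wedgeEval
  refine Finset.sum_congr (Finset.filter_congr fun σ _ => Iff.rfl) fun σ _ => rfl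

variable {ω} in
lemma wedgeTerm_mul_pairPerm (hω : ω.IsAlt) (v : Fin (2*n+1) → V) (σ : Equiv.Perm (Fin (2*n+1)))
    (π : Equiv.Perm (Fin n)) (ε : Fin n → Bool) :
    wedgeTerm α ω v (σ * pairPerm π ε) = wedgeTerm α ω v σ := by
  have hflip (i : Fin n) :
      ω (v (σ (pairIndex n (some (i, ε i))))) (v (σ (pairIndex n (some (i, !ε i))))) =
      (if ε i then -1 else 1) * ω (v (σ (pairIndex n (some (i, false)))))
        (v (σ (pairIndex n (some (i, true))))) := by
    cases ε i
    · simp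
    · simp [← hω.neg (v (σ (pairIndex n (some (i, true)))))]
  have hperm : ∏ i, ω (v (σ (pairIndex n (some (π i, ε (π i))))))
        (v (σ (pairIndex n (some (π i, !ε (π i)))))) =
      ∏ i, ω (v (σ (pairIndex n (some (i, ε i))))) (v (σ (pairIndex n (some (i, !ε i))))) :=
    Equiv.prod_comp π fun i =>
      ω (v (σ (pairIndex n (some (i, ε i))))) (v (σ (pairIndex n (some (i, !ε i)))))
  have hsq : (∏ i, (if ε i then (-1 : K) else 1)) * ∏ i, (if ε i then (-1 : K) else 1) = 1 := by
    rw [← Finset.prod_mul_distrib]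
    exact Finset.prod_eq_one fun i _ => by split_ifs <;> simp
  have hcast : (((∏ i, if ε i then -1 else 1 : ℤˣ) : ℤ) : K) =
      ∏ i, (if ε i then (-1 : K) else 1) := by
    push_cast
    exact Finset.prod_congr rfl fun i _ => by split_ifs <;> simp
  simp only [wedgeTerm, matchingProd, map_mul, sign_pairPerm, Function.comp_apply,
    Equiv.Perm.mul_apply, pairPerm_none, pairPerm_some, Bool.xor_false, Bool.xor_true]
  rw [hperm]
  simp only [hflip, Finset.prod_mul_distrib, zsmul_eq_mul, Units.val_mul, Int.cast_mul, hcast]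
  linear_combination ((Equiv.Perm.sign σ : ℤ) : K) * α (v (σ (pairIndex n none))) *
    (∏ i, ω (v (σ (pairIndex n (some (i, false))))) (v (σ (pairIndex n (some (i, true)))))) * hsq

variable {ω} in
lemma wedgeEval_eq_zero_of_eq (h2 : (2 : K) ≠ 0) (hω : ω.IsAlt) {v : Fin (2*n+1) → V}
    {i j : Fin (2*n+1)} (hv : v i = v j) (hij : i ≠ j) :
    wedgeEval K n (fun x => α x) (fun x y => ω x y) v = 0 := by
  classical
  choose π ε hN using exists_isNormalMatching_mul_pairPerm (n := n)
  set τ := Equiv.swap i j with hτ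
  have hvτ : v ∘ τ = v := by
    rw [hτ, Equiv.comp_swap_eq_update, hv, Function.update_eq_self, ← hv, Function.update_eq_self]
  have hanti (σ) : wedgeTerm α ω v (τ * σ) = -wedgeTerm α ω v σ := by
    have : v ∘ ⇑(τ * σ) ∘ pairIndex n = v ∘ σ ∘ pairIndex n :=
      congrArg (· ∘ σ ∘ pairIndex n) hvτ
    rw [wedgeTerm, this, Equiv.Perm.sign_mul, hτ, Equiv.Perm.sign_swap hij]
    simp [wedgeTerm]
  let N (σ : Equiv.Perm (Fin (2*n+1))) := τ * σ * pairPerm (π (τ * σ)) (ε (τ * σ))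
  have hNN (σ) (hσ : IsNormalMatching σ) : N (N σ) = σ := by
    have hdef : N (N σ) = σ * (pairPerm (π (τ * σ)) (ε (τ * σ)) *
        pairPerm (π (τ * N σ)) (ε (τ * N σ))) := by
      simp only [N, ← mul_assoc]
      simp [hτ]
    rw [hdef]
    refine hσ.eq_of_commute (hdef ▸ hN _) ?_
    exact (commute_pairPerm_pairSwap _ _).mul_left (commute_pairPerm_pairSwap _ _)
  have hsum : ∑ σ with IsNormalMatching σ, wedgeTerm α ω v σ =
      ∑ σ with IsNormalMatching σ, -wedgeTerm α ω v σ := by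
    refine Finset.sum_bij' (fun σ _ => N σ) (fun σ _ => N σ)
      (fun σ _ => by simpa using hN (τ * σ)) (fun σ _ => by simpa using hN (τ * σ))
      (fun σ hσ => hNN σ (by simpa using hσ)) (fun σ hσ => hNN σ (by simpa using hσ))
      (fun σ _ => ?_)
    rw [wedgeTerm_mul_pairPerm α hω, hanti, neg_neg]
  rw [Finset.sum_neg_distrib, ← wedgeEval_eq_sum_wedgeTerm] at hsum
  have : (2 : K) * wedgeEval K n (fun x => α x) (fun x y => ω x y) v = 0 := by
    linear_combination hsum
  exact (mul_eq_zero.1 this).resolve_left h2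

open Classical in
/-- `α ∧ ωⁿ` as a multilinear map. -/
noncomputable def wedgeMultilinear : MultilinearMap K (fun _ : Fin (2*n+1) => V) K :=
  ∑ σ : Equiv.Perm (Fin (2*n+1)) with IsNormalMatching σ,
    (Equiv.Perm.sign σ : ℤ) •
      (matchingProdMultilinear α ω).domDomCongr ((pairIndex n).trans σ)

lemma wedgeMultilinear_apply (v : Fin (2*n+1) → V) :
    wedgeMultilinear α ω v = wedgeEval K n (fun x => α x) (fun x y => ω x y) v := by
  classical
  rw [wedgeEval_eq_sum_wedgeTerm]
  simp only [wedgeMultilinear, wedgeTerm, sum_apply]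
  rfl

variable {ω} in
/-- `α ∧ ωⁿ` as an alternating map. -/
noncomputable def wedgeAlternating (h2 : (2 : K) ≠ 0) (hω : ω.IsAlt) :
    V [⋀^Fin (2*n+1)]→ₗ[K] K :=
  { wedgeMultilinear α ω with
    map_eq_zero_of_eq' := fun v _ _ hv hij =>
      (wedgeMultilinear_apply α ω v).trans (wedgeEval_eq_zero_of_eq α h2 hω hv hij) }

variable {ω} in
lemma wedgeAlternating_apply (h2 : (2 : K) ≠ 0) (hω : ω.IsAlt) (v : Fin (2*n+1) → V) :
    wedgeAlternating α h2 hω v = wedgeEval K n (fun x => α x) (fun x y => ω x y) v :=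
  wedgeMultilinear_apply α ω v

variable {ω} in
lemma eq_zero_of_wedgeEval_ne_zero [FiniteDimensional K V] (h2 : (2 : K) ≠ 0) (hω : ω.IsAlt)
    (hrank : Module.finrank K V = 2*n+1)
    (hwedge : ∃ v, wedgeEval K n (fun x => α x) (fun x y => ω x y) v ≠ 0)
    {u : V} (hα : α u = 0) (hu : ∀ y, ω u y = 0) : u = 0 := by
  classical
  by_contra hne
  obtain ⟨v, hv⟩ := hwedge
  have hli : LinearIndepOn K id {u} := LinearIndepOn.singleton hne
  let b₀ := Module.Basis.extend hli
  have : Fintype (hli.extend (Set.subset_univ _)) := FiniteDimensional.fintypeBasisIndex b₀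
  let e := Fintype.equivFinOfCardEq ((Module.finrank_eq_card_basis b₀).symm.trans hrank)
  let b := b₀.reindex e
  obtain ⟨i, hi⟩ : ∃ i, b i = u := by
    have hmem : u ∈ hli.extend (Set.subset_univ _) := hli.subset_extend _ (by simp)
    exact ⟨e ⟨u, hmem⟩, by simp [b, b₀]⟩
  have hu' (y) : ω y u = 0 := by rw [← hω.neg, hu, neg_zero]
  have hb : wedgeAlternating α h2 hω b = 0 := by
    rw [wedgeAlternating_apply, wedgeEval_eq_sum_wedgeTerm]
    refine Finset.sum_eq_zero fun σ _ => ?_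
    obtain ⟨k, rfl⟩ := ((pairIndex n).trans σ).surjective i
    simp only [Equiv.trans_apply] at hi
    suffices h : matchingProd α ω (b ∘ σ ∘ pairIndex n) = 0 by rw [wedgeTerm, h, smul_zero]
    rcases k with _ | ⟨j, _ | _⟩
    · simp [matchingProd, hi, hα]
    all_goals
      refine mul_eq_zero_of_right _ (Finset.prod_eq_zero (Finset.mem_univ j) ?_)
      simp [hi, hu, hu']
  refine hv ?_
  rw [← wedgeAlternating_apply α h2 hω,
    (wedgeAlternating α h2 hω).eq_smul_basis_det b, hb, zero_smul, AlternatingMap.zero_apply]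

end Wedge


section Reeb

variable {K V₁ V₂ : Type*} [Field K] [AddCommGroup V₁] [Module K V₁] [AddCommGroup V₂] [Module K V₂]

lemma reeb_mul_self_eq_zero [FiniteDimensional K V₁] {n : ℕ} (h2 : (2 : K) ≠ 0)
    (hrank : Module.finrank K V₁ = 2*n+1)
    {m : V₁ →ₗ[K] V₁ →ₗ[K] V₁} {α : V₁ →ₗ[K] K} {ω : V₁ →ₗ[K] V₁ →ₗ[K] K} (hω : ω.IsAlt)
    (hwedge : ∃ v, wedgeEval K n (fun x => α x) (fun x y => ω x y) v ≠ 0)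
    (hαcl : ∀ x y, α (m x y) = 0)
    (hωcl : ∀ x y z, ω (m x y) z + ω (m z x) y + ω (m y z) x = 0)
    {ξ : V₁} (hξ : ∀ y, ω ξ y = 0) : m ξ ξ = 0 := by
  refine eq_zero_of_wedgeEval_ne_zero α h2 hω hrank hwedge (hαcl ξ ξ) fun y => ?_
  have hr (z) : ω z ξ = 0 := by rw [← hω.neg, hξ, neg_zero]
  simpa [hr] using hωcl ξ ξ y

/-- An isomorphism of kernels of linear forms extends to the ambient spaces, with a prescribed
value on a vector complementary to the kernel. -/
lemma exists_extend_ker {α₁ : V₁ →ₗ[K] K} {α₂ : V₂ →ₗ[K] K} {ξ₁ : V₁} {ξ₂ : V₂}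
    (hξ₁ : α₁ ξ₁ = 1) (hξ₂ : α₂ ξ₂ = 1) (φ : LinearMap.ker α₁ ≃ₗ[K] LinearMap.ker α₂) :
    ∃ Φ : V₁ ≃ₗ[K] V₂, (∀ x : LinearMap.ker α₁, Φ x = φ x) ∧ Φ ξ₁ = ξ₂ ∧
      ∀ x, α₂ (Φ x) = α₁ x := by
  let p₁ : V₁ →ₗ[K] LinearMap.ker α₁ :=
    (LinearMap.id - α₁.smulRight ξ₁).codRestrict _ fun x => by simp [hξ₁]
  let p₂ : V₂ →ₗ[K] LinearMap.ker α₂ :=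
    (LinearMap.id - α₂.smulRight ξ₂).codRestrict _ fun x => by simp [hξ₂]
  let f : V₁ →ₗ[K] V₂ := (LinearMap.ker α₂).subtype ∘ₗ φ.toLinearMap ∘ₗ p₁ + α₁.smulRight ξ₂
  let g : V₂ →ₗ[K] V₁ :=
    (LinearMap.ker α₁).subtype ∘ₗ φ.symm.toLinearMap ∘ₗ p₂ + α₂.smulRight ξ₁
  have hf (x) : f x = φ (p₁ x) + α₁ x • ξ₂ := rfl
  have hg (x) : g x = φ.symm (p₂ x) + α₂ x • ξ₁ := rfl
  have hp₁' (x) : (p₁ x : V₁) = x - α₁ x • ξ₁ := rfl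
  have hp₂' (x) : (p₂ x : V₂) = x - α₂ x • ξ₂ := rfl
  have hp₁ (a : LinearMap.ker α₁) (c : K) : p₁ (a + c • ξ₁) = a := by
    ext; simp [hp₁', hξ₁]
  have hp₂ (a : LinearMap.ker α₂) (c : K) : p₂ (a + c • ξ₂) = a := by
    ext; simp [hp₂', hξ₂]
  have hα₁ (x) : α₁ (g x) = α₂ x := by simp [hg, hξ₁]
  have hα₂ (x) : α₂ (f x) = α₁ x := by simp [hf, hξ₂]
  refine ⟨LinearEquiv.ofLinearMap f g ?_ ?_, fun x => ?_, ?_, hα₂⟩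
  · ext x
    rw [LinearMap.comp_apply, hf, hα₁, hg, hp₁]
    simp [hp₂']
  · ext x
    rw [LinearMap.comp_apply, hg, hα₂, hf, hp₂]
    simp [hp₁']
  · have : p₁ x = x := by simpa using hp₁ x 0
    simp [hf, this]
  · have : p₁ ξ₁ = 0 := by simpa using hp₁ 0 1
    simp [hf, this, hξ₁]

end Reeb

/-- Two `(2n+1)`-dimensional cosymplectic JJ-algebras are isomorphic (as
cosymplectic JJ-algebras) if and only if the associated `2n`-dimensional symplectic
JJ-algebras `h_i = ker α_i` (with forms `ω_i|_{h_i}` and anti-derivations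
`D_i(x) = ξ_i·x`) are isomorphic via a symplectic JJ-algebra isomorphism `φ`
intertwining the anti-derivations: `φ ∘ D₁ = D₂ ∘ φ`. -/
theorem stmt13 {K V₁ V₂ : Type*} [Field K]
    [AddCommGroup V₁] [Module K V₁] [FiniteDimensional K V₁]
    [AddCommGroup V₂] [Module K V₂] [FiniteDimensional K V₂]
    (h2 : (2 : K) ≠ 0) (h3 : (3 : K) ≠ 0) (n : ℕ)
    (hrank₁ : Module.finrank K V₁ = 2*n+1)
    (m₁ : V₁ →ₗ[K] V₁ →ₗ[K] V₁)
    (hcomm₁ : ∀ x y, m₁ x y = m₁ y x)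
    (hjac₁ : ∀ x y z, m₁ x (m₁ y z) + m₁ y (m₁ z x) + m₁ z (m₁ x y) = 0)
    (α₁ : V₁ →ₗ[K] K) (ω₁ : V₁ →ₗ[K] V₁ →ₗ[K] K)
    (halt₁ : ∀ x, ω₁ x x = 0)
    (hwedge₁ : ∃ v, wedgeEval K n (fun x => α₁ x) (fun x y => ω₁ x y) v ≠ 0)
    (hαcl₁ : ∀ x y, α₁ (m₁ x y) = 0)
    (hωcl₁ : ∀ x y z, ω₁ (m₁ x y) z + ω₁ (m₁ z x) y + ω₁ (m₁ y z) x = 0)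
    (ξ₁ : V₁) (hξ₁1 : α₁ ξ₁ = 1) (hξ₁0 : ∀ y, ω₁ ξ₁ y = 0)
    (hrank₂ : Module.finrank K V₂ = 2*n+1)
    (m₂ : V₂ →ₗ[K] V₂ →ₗ[K] V₂)
    (hcomm₂ : ∀ x y, m₂ x y = m₂ y x)
    (hjac₂ : ∀ x y z, m₂ x (m₂ y z) + m₂ y (m₂ z x) + m₂ z (m₂ x y) = 0)
    (α₂ : V₂ →ₗ[K] K) (ω₂ : V₂ →ₗ[K] V₂ →ₗ[K] K)
    (halt₂ : ∀ x, ω₂ x x = 0)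
    (hwedge₂ : ∃ v, wedgeEval K n (fun x => α₂ x) (fun x y => ω₂ x y) v ≠ 0)
    (hαcl₂ : ∀ x y, α₂ (m₂ x y) = 0)
    (hωcl₂ : ∀ x y z, ω₂ (m₂ x y) z + ω₂ (m₂ z x) y + ω₂ (m₂ y z) x = 0)
    (ξ₂ : V₂) (hξ₂1 : α₂ ξ₂ = 1) (hξ₂0 : ∀ y, ω₂ ξ₂ y = 0) :
    (∃ Φ : V₁ ≃ₗ[K] V₂,
        (∀ x y, Φ (m₁ x y) = m₂ (Φ x) (Φ y)) ∧
        (∀ x y, ω₂ (Φ x) (Φ y) = ω₁ x y) ∧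
        (∀ x, α₂ (Φ x) = α₁ x)) ↔
    (∃ φ : (LinearMap.ker α₁) ≃ₗ[K] (LinearMap.ker α₂),
        (∀ x y : LinearMap.ker α₁,
          (φ ⟨m₁ x y, LinearMap.mem_ker.mpr (hαcl₁ x y)⟩ : V₂) = m₂ (φ x) (φ y)) ∧
        (∀ x y : LinearMap.ker α₁, ω₂ (φ x) (φ y) = ω₁ x y) ∧
        (∀ x : LinearMap.ker α₁,
          (φ ⟨m₁ ξ₁ x, LinearMap.mem_ker.mpr (hαcl₁ ξ₁ x)⟩ : V₂) = m₂ ξ₂ (φ x))) := by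
  have hω₁ : ω₁.IsAlt := halt₁
  have hω₂ : ω₂.IsAlt := halt₂
  constructor
  · rintro ⟨Φ, hm, hω, hα⟩
    have hξ : Φ ξ₁ = ξ₂ := by
      refine sub_eq_zero.1 (eq_zero_of_wedgeEval_ne_zero α₂ h2 hω₂ hrank₂ hwedge₂ ?_ fun y => ?_)
      · rw [map_sub, hα, hξ₁1, hξ₂1, sub_self]
      · obtain ⟨x, rfl⟩ := Φ.surjective y
        rw [map_sub, LinearMap.sub_apply, hω, hξ₁0, hξ₂0, sub_self]
    refine ⟨Φ.ofSubmodules _ _ ?_, fun x y => hm x y, fun x y => hω x y, fun x => ?_⟩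
    · ext y
      obtain ⟨x, rfl⟩ := Φ.surjective y
      simp [hα]
    · rw [← hξ]
      exact hm ξ₁ x
  · rintro ⟨φ, hm, hω, hD⟩
    have hsq₁ : m₁ ξ₁ ξ₁ = 0 :=
      reeb_mul_self_eq_zero h2 hrank₁ hω₁ hwedge₁ hαcl₁ hωcl₁ hξ₁0
    have hsq₂ : m₂ ξ₂ ξ₂ = 0 :=
      reeb_mul_self_eq_zero h2 hrank₂ hω₂ hwedge₂ hαcl₂ hωcl₂ hξ₂0
    obtain ⟨Φ, hΦ, hΦξ, hα⟩ := exists_extend_ker hξ₁1 hξ₂1 φ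
    have hr₁ (y) : ω₁ y ξ₁ = 0 := by rw [← hω₁.neg, hξ₁0, neg_zero]
    have hr₂ (y) : ω₂ y ξ₂ = 0 := by rw [← hω₂.neg, hξ₂0, neg_zero]
    have hdecomp (x : V₁) : ∃ (a : LinearMap.ker α₁) (c : K), x = a + c • ξ₁ :=
      ⟨⟨x - α₁ x • ξ₁, by simp [hξ₁1]⟩, α₁ x, by simp⟩
    refine ⟨Φ, fun x y => ?_, fun x y => ?_, hα⟩
    · obtain ⟨a, c, rfl⟩ := hdecomp x
      obtain ⟨b, d, rfl⟩ := hdecomp y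
      have hab : Φ (m₁ a b) = m₂ (φ a) (φ b) := (hΦ ⟨m₁ a b, _⟩).trans (hm a b)
      have hξ (a : LinearMap.ker α₁) : Φ (m₁ ξ₁ a) = m₂ ξ₂ (φ a) :=
        (hΦ ⟨m₁ ξ₁ a, _⟩).trans (hD a)
      simp [hcomm₁ _ ξ₁, hcomm₂ _ ξ₂, hΦ, hΦξ, hsq₁, hsq₂, hab, hξ]
    · obtain ⟨a, c, rfl⟩ := hdecomp x
      obtain ⟨b, d, rfl⟩ := hdecomp y
      simp [hΦ, hΦξ, hξ₁0, hξ₂0, hr₁, hr₂, hω]
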